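/- Let p be a probability kernel on ℤ^d and γ ≥ 0, and let L be the generator L G(ξ) := ∑_{v,w∈ℤ^d} ξ(v)·p(w−v)·(G(ξ^{v→w}) − G(ξ)) + (γ/2)·∑_{v≠0} 1_{ξ(v)=1}·(G(ξ^{+v}) + G(ξ^{−v}) − 2G(ξ)) + γ·1_{ξ(0)=0}·(G(ξ^{+0}) − G(ξ)) + ∑_{z∈ℤ^d} p(z)·(G(θ_z ξ) − G(ξ)), where (θ_z ξ)(y) := ξ(z+y). For a,b ∈ ℤ^d define F_{a,b}(ξ) := ξ(a)·(ξ(b) − δ_{ab}) ∈ ℤ. Then for all x,y ∈ ℤ^d and every configuration ξ, all the series converge absolutely and L F_{x,y}(ξ) = ∑_{z∈ℤ^d} p(−z)·(F_{x,y+z}(ξ) + F_{x+z,y}(ξ) + F_{x−z,y−z}(ξ) − 3·F_{x,y}(ξ)) + γ·1_{ξ(x)=1}·δ_{xy}·(1−δ_{x0}) + γ·1_{ξ(0)=0}·(δ_{x0}·ξ(y) + δ_{y0}·ξ(x)). -/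

import Mathlib

/-- `ξ^{x→y}`: one particle moved from `x` to `y`. -/
noncomputable def moveTo {G : Type*} [DecidableEq G] (ξ : G →₀ ℕ) (x y : G) : G →₀ ℕ :=
  ξ - Finsupp.single x 1 + Finsupp.single y 1

/-- `ξ^{+x}`: one particle added at `x`. -/
noncomputable def addAt {G : Type*} [DecidableEq G] (ξ : G →₀ ℕ) (x : G) : G →₀ ℕ :=
  ξ + Finsupp.single x 1

/-- `ξ^{−x}`: one particle removed at `x`. -/
noncomputable def subAt {G : Type*} [DecidableEq G] (ξ : G →₀ ℕ) (x : G) : G →₀ ℕ :=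
  ξ - Finsupp.single x 1

/-- `F_{a,b}(ξ) = ξ(a)(ξ(b) − δ_{ab})`, the number of ordered pairs of distinct particles at
`(a,b)`. -/
noncomputable def pairCount {G : Type*} [DecidableEq G] (ξ : G →₀ ℕ) (a b : G) : ℝ :=
  (ξ a : ℝ) * ((ξ b : ℝ) - if a = b then 1 else 0)

section PairCountGenerator

variable {G : Type*}

theorem summable_mul_finsupp_comp {H : Type*} (ξ : G →₀ ℕ) (f : H → ℝ) {e : H → G}
    (he : Function.Injective e) : Summable fun z => f z * (ξ (e z) : ℝ) := by
  apply summable_of_hasFiniteSupport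
  refine (ξ.hasFiniteSupport.preimage he.injOn).subset fun z hz => ?_
  simp only [Function.mem_support, Set.mem_preimage] at hz ⊢
  intro h
  simp [h] at hz

variable [DecidableEq G]

theorem pairCount_moveTo_sub (ξ : G →₀ ℕ) (v w x y : G) (hv : ξ v ≠ 0) :
    pairCount (moveTo ξ v w) x y - pairCount ξ x y =
      (((if w = x then 1 else 0) - if v = x then 1 else 0) * (ξ y : ℝ)
        + ((if w = y then 1 else 0) - if v = y then 1 else 0) * (ξ x : ℝ)
        + ((if w = x then 1 else 0) - if v = x then 1 else 0)
          * ((if w = y then 1 else 0) - if v = y then 1 else 0)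
        - (if x = y then 1 else 0) * ((if w = x then 1 else 0) - if v = x then 1 else 0)) := by
  have key (u : G) : (moveTo ξ v w u : ℝ) =
      ξ u + ((if w = u then 1 else 0) - if v = u then 1 else 0) := by
    have h : moveTo ξ v w u = ξ u - (if v = u then 1 else 0) + if w = u then 1 else 0 := by
      simp [moveTo, Finsupp.single_apply]
    have h' : (if v = u then 1 else 0) ≤ ξ u := by
      split_ifs with hvu
      · subst hvu; omega
      · omega
    rw [h, Nat.cast_add, Nat.cast_sub h']
    push_cast
    ring
  simp only [pairCount, key]
  ring

theorem pairCount_addAt_sub (ξ : G →₀ ℕ) (v x y : G) (hv : ξ v = 0) :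
    pairCount (addAt ξ v) x y - pairCount ξ x y =
      (if x = v then 1 else 0) * (ξ y : ℝ) + (if y = v then 1 else 0) * (ξ x : ℝ) := by
  simp only [pairCount, addAt, Finsupp.add_apply, Finsupp.single_apply, eq_comm (a := v)]
  split_ifs <;> simp_all

theorem pairCount_addAt_add_subAt (ξ : G →₀ ℕ) (v x y : G) (hv : ξ v = 1) :
    pairCount (addAt ξ v) x y + pairCount (subAt ξ v) x y - 2 * pairCount ξ x y =
      if v = x ∧ x = y then 2 else 0 := by
  have hadd (u : G) : (addAt ξ v u : ℝ) = ξ u + if v = u then 1 else 0 := by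
    simp [addAt, Finsupp.single_apply]
  have hsub (u : G) : (subAt ξ v u : ℝ) = ξ u - if v = u then 1 else 0 := by
    by_cases h : v = u
    · subst h; simp [subAt, hv]
    · simp [subAt, h]
  simp only [pairCount, hadd, hsub]
  by_cases hx : v = x <;> by_cases hy : v = y <;> by_cases hxy : x = y <;> simp_all
  all_goals try ring

theorem tsum_branching [Zero G] (ξ : G →₀ ℕ) (x y : G) :
    (∑' v : G, if v ≠ 0 ∧ ξ v = 1 then
      pairCount (addAt ξ v) x y + pairCount (subAt ξ v) x y - 2 * pairCount ξ x y else 0) =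
      2 * ((if ξ x = 1 then 1 else 0) * (if x = y then 1 else 0)
        * (1 - if x = 0 then 1 else 0)) := by
  have h (v : G) : (if v ≠ 0 ∧ ξ v = 1 then
      pairCount (addAt ξ v) x y + pairCount (subAt ξ v) x y - 2 * pairCount ξ x y else 0) =
      if v = x then 2 * ((if ξ x = 1 then 1 else 0) * (if x = y then 1 else 0)
        * (1 - if x = 0 then 1 else 0)) else 0 := by
    by_cases hv : v ≠ 0 ∧ ξ v = 1
    · rw [if_pos hv, pairCount_addAt_add_subAt ξ v x y hv.2]
      by_cases hx : v = x
      · subst hx; simp [hv.1, hv.2]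
      · simp [hx]
    · rw [if_neg hv]
      by_cases hx : v = x
      · subst hx
        by_cases h0 : v = 0 <;> simp_all
      · simp [hx]
  simp_rw [h]
  exact tsum_ite_eq x _

theorem summable_mul_pairCount_comp {H : Type*} (ξ : G →₀ ℕ) (f : H → ℝ) {e : H → G}
    (he : Function.Injective e) (e' : H → G) :
    Summable fun z => f z * pairCount ξ (e z) (e' z) := by
  convert summable_mul_finsupp_comp ξ
    (fun z => f z * ((ξ (e' z) : ℝ) - if e z = e' z then 1 else 0)) he using 2
  simp only [pairCount]
  ring

variable [AddCommGroup G] {p : G → ℝ}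

theorem hasSum_jump_arrivals (ξ : G →₀ ℕ) (p : G → ℝ) (x : G) :
    HasSum (fun vw : G × G => (ξ vw.1 : ℝ) * p (vw.2 - vw.1) * if vw.2 = x then 1 else 0)
      (∑' z, p (-z) * (ξ (x + z) : ℝ)) := by
  have hinj : Function.Injective fun z : G => (x + z, x) := fun a b h => by simpa using h
  refine (hinj.hasSum_iff fun vw hvw => ?_).1 ?_
  · rw [if_neg, mul_zero]
    rintro rfl
    exact hvw ⟨vw.1 - vw.2, by simp⟩
  · convert (summable_mul_finsupp_comp ξ (fun z => p (-z)) (add_right_injective x)).hasSum using 2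
    simp [mul_comm]

theorem hasSum_jump_departures (ξ : G →₀ ℕ) (hp : HasSum p 1) (x : G) :
    HasSum (fun vw : G × G => (ξ vw.1 : ℝ) * p (vw.2 - vw.1) * if vw.1 = x then 1 else 0)
      (ξ x) := by
  have hinj : Function.Injective fun z : G => (x, x + z) := fun a b h => by simpa using h
  refine (hinj.hasSum_iff fun vw hvw => ?_).1 ?_
  · rw [if_neg, mul_zero]
    rintro rfl
    exact hvw ⟨vw.2 - vw.1, by simp⟩
  · simpa [Function.comp_def] using hp.mul_left (ξ x : ℝ)

theorem hasSum_jump_single (ξ : G →₀ ℕ) (p : G → ℝ) (x y : G) :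
    HasSum (fun vw : G × G => (ξ vw.1 : ℝ) * p (vw.2 - vw.1) *
      ((if vw.1 = x then 1 else 0) * if vw.2 = y then 1 else 0)) (ξ x * p (y - x)) := by
  convert hasSum_single (f := fun vw : G × G => (ξ vw.1 : ℝ) * p (vw.2 - vw.1) *
      ((if vw.1 = x then 1 else 0) * if vw.2 = y then 1 else 0)) (x, y) ?_ using 1
  · simp
  · rintro ⟨v, w⟩ h
    have : ¬ (v = x ∧ w = y) := by simpa using h
    by_cases hv : v = x <;> simp_all

theorem hasSum_jump (ξ : G →₀ ℕ) (hp : HasSum p 1) (x y : G) :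
    HasSum (fun vw : G × G =>
        (ξ vw.1 : ℝ) * p (vw.2 - vw.1) * (pairCount (moveTo ξ vw.1 vw.2) x y - pairCount ξ x y))
      (ξ y * (∑' z, p (-z) * (ξ (x + z) : ℝ)) + ξ x * (∑' z, p (-z) * (ξ (y + z) : ℝ))
        - ξ x * p (y - x) - ξ y * p (x - y) - 2 * pairCount ξ x y) := by
  have hax := hasSum_jump_arrivals ξ p x
  have hay := hasSum_jump_arrivals ξ p y
  have hdx := hasSum_jump_departures ξ hp x
  have hdy := hasSum_jump_departures ξ hp y
  have hxy := hasSum_jump_single ξ p x y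
  have hyx := hasSum_jump_single ξ p y x
  convert (((((hax.sub hdx).mul_left (ξ y : ℝ)).add ((hay.sub hdy).mul_left (ξ x : ℝ))).sub
    hxy).sub hyx).add (hdx.mul_left (2 * if x = y then (1 : ℝ) else 0)) using 1
  · rfl
  · funext ⟨v, w⟩
    by_cases hv : ξ v = 0
    · simp [hv]
    · simp only [pairCount_moveTo_sub ξ v w x y hv]
      by_cases h : x = y
      · subst h
        by_cases h1 : v = x <;> by_cases h2 : w = x <;> simp [h1, h2] <;> ring
      · have h1 : (if w = x then (1 : ℝ) else 0) * (if w = y then 1 else 0) = 0 := by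
          by_cases hw : w = x <;> simp_all
        have h2 : (if v = x then (1 : ℝ) else 0) * (if v = y then 1 else 0) = 0 := by
          by_cases hw : v = x <;> simp_all
        rw [if_neg h]
        linear_combination (ξ v : ℝ) * p (w - v) * (h1 + h2)
  · by_cases h : x = y
    · subst h; simp [pairCount]; ring
    · simp [pairCount, h]; ring

theorem hasSum_shift (ξ : G →₀ ℕ) (hp : HasSum p 1) (x y : G) :
    HasSum (fun z => p z *
        ((ξ (z + x) : ℝ) * ((ξ (z + y) : ℝ) - if x = y then 1 else 0) - pairCount ξ x y))
      ((∑' z, p (-z) * pairCount ξ (x - z) (y - z)) - pairCount ξ x y) := by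
  have h := (summable_mul_pairCount_comp ξ (fun z => p (-z)) (sub_right_injective (b := x))
    (fun z => y - z)).hasSum
  rw [← (Equiv.neg G).hasSum_iff] at h
  convert h.sub (hp.mul_right (pairCount ξ x y)) using 1
  · rfl
  · funext z
    simp [pairCount, add_comm z, mul_sub]
  · ring

theorem hasSum_pairCount_target (ξ : G →₀ ℕ) (hp : HasSum p 1) (x y : G) :
    HasSum (fun z => p (-z) *
        (pairCount ξ x (y + z) + pairCount ξ (x + z) y + pairCount ξ (x - z) (y - z)
          - 3 * pairCount ξ x y))
      (ξ x * (∑' z, p (-z) * (ξ (y + z) : ℝ)) - ξ x * p (y - x)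
        + (ξ y * (∑' z, p (-z) * (ξ (x + z) : ℝ)) - ξ y * p (x - y))
        + (∑' z, p (-z) * pairCount ξ (x - z) (y - z)) - 3 * pairCount ξ x y) := by
  have hone (a b : G) : HasSum (fun z => p (-z) * pairCount ξ a (b + z))
      (ξ a * (∑' z, p (-z) * (ξ (b + z) : ℝ)) - ξ a * p (b - a)) := by
    have h := (summable_mul_finsupp_comp ξ (fun z => p (-z)) (add_right_injective b)).hasSum
    convert (h.mul_left (ξ a : ℝ)).sub
      (hasSum_ite_eq (a - b) ((ξ a : ℝ) * p (b - a))) using 1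
    · rfl
    funext z
    by_cases hz : z = a - b
    · subst hz; simp [pairCount]; ring
    · have : a ≠ b + z := fun h => hz (by rw [h]; abel)
      simp [pairCount, hz, this]; ring
  have hcomm (a b : G) : pairCount ξ a b = pairCount ξ b a := by
    by_cases h : a = b
    · rw [h]
    · simp [pairCount, h, Ne.symm h, mul_comm]
  have hneg : HasSum (fun z => p (-z)) 1 := (Equiv.neg G).hasSum_iff.2 hp
  have hs := (summable_mul_pairCount_comp ξ (fun z => p (-z)) (sub_right_injective (b := x))
    (fun z => y - z)).hasSum
  convert (((hone x y).add (hone y x)).add hs).sub (hneg.mul_right (3 * pairCount ξ x y)) using 1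
  · rfl
  · funext z
    rw [hcomm (x + z) y]
    ring
  · ring

end PairCountGenerator

/-- the generator of the size-biased process seen from the immigration source,
applied to `F_{x,y}(ξ) = ξ(x)(ξ(y) − δ_{xy})`; all series converge absolutely. -/
theorem stmt_16 (d : ℕ) (hd : 1 ≤ d)
    (p : (Fin d → ℤ) → ℝ) (hp : ∀ x, 0 ≤ p x) (hp1 : ∑' x, p x = 1)
    (γ : ℝ) (hγ : 0 ≤ γ) :
    ∀ x y : Fin d → ℤ, ∀ ξ : (Fin d → ℤ) →₀ ℕ,
      (Summable fun vw : (Fin d → ℤ) × (Fin d → ℤ) =>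
        (ξ vw.1 : ℝ) * p (vw.2 - vw.1) * (pairCount (moveTo ξ vw.1 vw.2) x y - pairCount ξ x y)) ∧
      (Summable fun z : Fin d → ℤ => p z *
        ((ξ (z + x) : ℝ) * ((ξ (z + y) : ℝ) - if x = y then 1 else 0) - pairCount ξ x y)) ∧
      (Summable fun z : Fin d → ℤ => p (-z) *
        (pairCount ξ x (y + z) + pairCount ξ (x + z) y + pairCount ξ (x - z) (y - z)
          - 3 * pairCount ξ x y)) ∧
      (∑' vw : (Fin d → ℤ) × (Fin d → ℤ),
          (ξ vw.1 : ℝ) * p (vw.2 - vw.1) * (pairCount (moveTo ξ vw.1 vw.2) x y - pairCount ξ x y))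
        + (γ / 2) * (∑' v : Fin d → ℤ,
            if v ≠ 0 ∧ ξ v = 1 then
              pairCount (addAt ξ v) x y + pairCount (subAt ξ v) x y - 2 * pairCount ξ x y
            else 0)
        + γ * (if ξ 0 = 0 then pairCount (addAt ξ 0) x y - pairCount ξ x y else 0)
        + (∑' z : Fin d → ℤ, p z *
            ((ξ (z + x) : ℝ) * ((ξ (z + y) : ℝ) - if x = y then 1 else 0) - pairCount ξ x y))
      = (∑' z : Fin d → ℤ, p (-z) *
            (pairCount ξ x (y + z) + pairCount ξ (x + z) y + pairCount ξ (x - z) (y - z)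
              - 3 * pairCount ξ x y))
        + γ * (if ξ x = 1 then 1 else 0) * (if x = y then 1 else 0)
            * (1 - if x = 0 then 1 else 0)
        + γ * (if ξ 0 = 0 then 1 else 0)
            * ((if x = 0 then 1 else 0) * (ξ y : ℝ) + (if y = 0 then 1 else 0) * (ξ x : ℝ)) := by
  intro x y ξ
  have hps : HasSum p 1 := by
    have : Summable p := by
      by_contra h
      simp [tsum_eq_zero_of_not_summable h] at hp1
    exact hp1 ▸ this.hasSum
  have hJ := hasSum_jump ξ hps x y
  have hS := hasSum_shift ξ hps x y
  have hT := hasSum_pairCount_target ξ hps x y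
  refine ⟨hJ.summable, hS.summable, hT.summable, ?_⟩
  rw [hJ.tsum_eq, hS.tsum_eq, hT.tsum_eq, tsum_branching]
  by_cases h0 : ξ 0 = 0
  · rw [if_pos h0, if_pos h0, pairCount_addAt_sub ξ 0 x y h0]
    ring
  · rw [if_neg h0, if_neg h0]
    ring
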